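/- Let (x₀, ξ₀) ∈ S* and let γ(t) = (x_t, ξ_t), t ∈ [0, τ], be a Lipschitz curve with γ(0) = (x₀, ξ₀), g(x_t) ≠ 0 for t ∈ (0, τ], differentiable on (0, τ] with ẋ_t = ξ_t, ξ̇_t = −∇V(x_t) (an outgoing broken trajectory through (x₀, ξ₀)). For t ∈ (0, τ], let M(t) be the 2d×2d real matrix with block form M(t) = [[0, Id],[−d²V(x_t), 0]], where d²V(x_t) is the Hessian of V at x_t (defined since g(x_t) ≠ 0). Then for every η ∈ ℝ^d there exist τ' ∈ (0, τ] and a unique continuous map J : [0, τ'] → ℝ^{2d} with J(0) = (0, η) which is differentiable on (0, τ'] and satisfies J'(t) = M(t) J(t) for all t ∈ (0, τ']. (This J is the ξ-derivative of the generalized flow along the broken trajectory; note that ‖d²V(x_t)‖ may blow up like 1/t as t → 0⁺.) -/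

import Mathlib

open Set Filter Topology MeasureTheory

section LinearSystem

variable {E : Type*} [NormedAddCommGroup E] [NormedSpace ℝ E]

/-- Mean value inequality on `[0, T]` which needs no derivative at the endpoints. -/
theorem norm_image_sub_le_mul_of_hasDerivAt_Ioo {f f' : ℝ → E} {T B : ℝ}
    (hf : ContinuousOn f (Icc 0 T)) (hf' : ∀ t ∈ Ioo 0 T, HasDerivAt f (f' t) t)
    (hB : ∀ t ∈ Ioo 0 T, ‖f' t‖ ≤ B) {t : ℝ} (ht : t ∈ Icc 0 T) : ‖f t - f 0‖ ≤ B * t := by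
  rcases ht.1.eq_or_lt with rfl | h0
  · simp
  have hle : ∀ s ∈ Ioc 0 t, ‖f t - f s‖ ≤ B * (t - s) := fun s hs ↦
    norm_image_sub_le_of_norm_deriv_right_le_segment
      (hf.mono (Icc_subset_Icc hs.1.le ht.2))
      (fun r hr ↦ (hf' r ⟨hs.1.trans_le hr.1, hr.2.trans_le ht.2⟩).hasDerivWithinAt)
      (fun r hr ↦ hB r ⟨hs.1.trans_le hr.1, hr.2.trans_le ht.2⟩) t ⟨hs.2, le_rfl⟩
  have hlim : Tendsto f (𝓝[>] 0) (𝓝 (f 0)) :=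
    ((hf 0 ⟨le_rfl, h0.le.trans ht.2⟩).mono_of_mem_nhdsWithin
      (Icc_mem_nhdsGT (h0.trans_le ht.2)))
  have hid : Tendsto (fun s : ℝ ↦ B * (t - s)) (𝓝[>] 0) (𝓝 (B * (t - 0))) :=
    ((continuous_const.mul (continuous_const.sub continuous_id)).tendsto 0).mono_left
      nhdsWithin_le_nhds
  rw [sub_zero] at hid
  refine le_of_tendsto_of_tendsto (tendsto_const_nhds.sub hlim).norm hid ?_
  filter_upwards [Ioc_mem_nhdsGT h0] with s hs using hle s hs

/-- Uniqueness for `a' = b`, `b' = -H a` when `H` blows up at most like `C / t` at `0`. -/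
theorem eq_zero_of_hasDerivAt_of_singular {H : ℝ → E →L[ℝ] E} {T C : ℝ} (hC : 0 ≤ C)
    (hCT : C * T ≤ 1 / 2) (hbd : ∀ t ∈ Ioc 0 T, ‖H t‖ * t ≤ C) {a b : ℝ → E}
    (ha : ContinuousOn a (Icc 0 T)) (hb : ContinuousOn b (Icc 0 T)) (ha0 : a 0 = 0)
    (hb0 : b 0 = 0) (ha' : ∀ t ∈ Ioo 0 T, HasDerivAt a (b t) t)
    (hb' : ∀ t ∈ Ioo 0 T, HasDerivAt b (-(H t (a t))) t) {t : ℝ} (ht : t ∈ Icc 0 T) :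
    a t = 0 ∧ b t = 0 := by
  obtain ⟨m, hm, hmax⟩ := isCompact_Icc.exists_isMaxOn ⟨t, ht⟩ hb.norm
  have hbm : ∀ s ∈ Icc 0 T, ‖b s‖ ≤ ‖b m‖ := fun s hs ↦ hmax hs
  have hale : ∀ s ∈ Icc 0 T, ‖a s‖ ≤ ‖b m‖ * s := fun s hs ↦ by
    simpa [ha0] using norm_image_sub_le_mul_of_hasDerivAt_Ioo ha ha'
      (fun r hr ↦ hbm r (Ioo_subset_Icc_self hr)) hs
  have hHa : ∀ s ∈ Ioo 0 T, ‖-(H s (a s))‖ ≤ C * ‖b m‖ := fun s hs ↦ by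
    rw [norm_neg]
    calc ‖H s (a s)‖ ≤ ‖H s‖ * ‖a s‖ := (H s).le_opNorm _
      _ ≤ ‖H s‖ * (‖b m‖ * s) := by gcongr; exact hale s (Ioo_subset_Icc_self hs)
      _ = ‖H s‖ * s * ‖b m‖ := by ring
      _ ≤ C * ‖b m‖ := by gcongr; exact hbd s (Ioo_subset_Ioc_self hs)
  have hbm0 : ‖b m‖ = 0 := by
    have h := norm_image_sub_le_mul_of_hasDerivAt_Ioo hb hb' hHa hm
    rw [hb0, sub_zero] at h
    have h2 : C * ‖b m‖ * m ≤ C * ‖b m‖ * T := by gcongr; exact hm.2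
    nlinarith [norm_nonneg (b m)]
  constructor
  · simpa [hbm0] using hale t ht
  · simpa [hbm0] using hbm t ht

/-- Existence for `a' = b`, `b' = -H a`, `a 0 = 0`, `b 0 = η` when `H` blows up at most like
`C / t` at `0`. -/
theorem exists_hasDerivAt_of_singular [CompleteSpace E] {H : ℝ → E →L[ℝ] E} {T C : ℝ}
    (hT : 0 < T) (hCT : C * T ≤ 1 / 2) (hH : ContinuousOn H (Ioc 0 T))
    (hbd : ∀ t ∈ Ioc 0 T, ‖H t‖ * t ≤ C) (η : E) :
    ∃ a b : ℝ → E, Continuous a ∧ Continuous b ∧ a 0 = 0 ∧ b 0 = η ∧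
      (∀ t, HasDerivAt a (b t) t) ∧ ∀ t ∈ Ioo 0 T, HasDerivAt b (-(H t (a t))) t := by
  let A (b : BoundedContinuousFunction ℝ E) (s : ℝ) : E := ∫ r in (0 : ℝ)..s, b r
  let F (b : BoundedContinuousFunction ℝ E) : ℝ → E := (Ioc 0 T).indicator fun s ↦ H s (A b s)
  have hA' : ∀ b s, HasDerivAt (A b) (b s) s := fun b s ↦ b.continuous.integral_hasStrictDerivAt 0 s
    |>.hasDerivAt
  have hAc : ∀ b, Continuous (A b) := fun b ↦
    continuous_iff_continuousAt.2 fun s ↦ (hA' b s).continuousAt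
  have hHA : ∀ b, ContinuousOn (fun s ↦ H s (A b s)) (Ioc 0 T) := fun b ↦
    hH.clm_apply (hAc b).continuousOn
  have hbound : ∀ b, ∀ s ∈ Ioc 0 T, ‖H s (A b s)‖ ≤ C * ‖b‖ := fun b s hs ↦ by
    have h1 : ‖A b s‖ ≤ ‖b‖ * |s - 0| :=
      intervalIntegral.norm_integral_le_of_norm_le_const fun r _ ↦ b.norm_coe_le_norm r
    rw [sub_zero, abs_of_pos hs.1] at h1
    calc ‖H s (A b s)‖ ≤ ‖H s‖ * ‖A b s‖ := (H s).le_opNorm _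
      _ ≤ ‖H s‖ * (‖b‖ * s) := by gcongr
      _ = ‖H s‖ * s * ‖b‖ := by ring
      _ ≤ C * ‖b‖ := by gcongr; exact hbd s hs
  have hFint : ∀ b, Integrable (F b) := fun b ↦ by
    rw [integrable_indicator_iff measurableSet_Ioc]
    exact IntegrableOn.of_bound (by simp) ((hHA b).aestronglyMeasurable measurableSet_Ioc) _
      ((ae_restrict_iff' measurableSet_Ioc).2 (.of_forall (hbound b)))
  have hIle : ∀ b t, ‖∫ s in (0 : ℝ)..t, F b s‖ ≤ C * T * ‖b‖ := fun b t ↦ by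
    calc ‖∫ s in (0 : ℝ)..t, F b s‖ ≤ ∫ s in uIoc 0 t, ‖F b s‖ :=
          intervalIntegral.norm_integral_le_integral_norm_uIoc
      _ ≤ ∫ s, ‖F b s‖ := setIntegral_le_integral (hFint b).norm (.of_forall fun _ ↦ norm_nonneg _)
      _ = ∫ s in Ioc 0 T, ‖H s (A b s)‖ := by
          simp only [F, norm_indicator_eq_indicator_norm]
          exact integral_indicator measurableSet_Ioc
      _ ≤ ‖∫ s in Ioc 0 T, ‖H s (A b s)‖‖ := Real.le_norm_self _
      _ ≤ C * ‖b‖ * volume.real (Ioc 0 T) :=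
          norm_setIntegral_le_of_norm_le_const (by simp) fun s hs ↦ by
            simpa using hbound b s hs
      _ = C * T * ‖b‖ := by simp [hT.le]; ring
  have hIc : ∀ b, Continuous fun t ↦ ∫ s in (0 : ℝ)..t, F b s := fun b ↦
    intervalIntegral.continuous_primitive (fun _ _ ↦ (hFint b).intervalIntegrable) 0
  let Φ (b : BoundedContinuousFunction ℝ E) : BoundedContinuousFunction ℝ E :=
    BoundedContinuousFunction.ofNormedAddCommGroup (fun t ↦ η - ∫ s in (0 : ℝ)..t, F b s)
      (continuous_const.sub (hIc b)) (‖η‖ + C * T * ‖b‖)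
      fun t ↦ (norm_sub_le _ _).trans (by gcongr; exact hIle b t)
  have hFsub : ∀ b c s, F b s - F c s = F (b - c) s := fun b c s ↦ by
    have hAsub : A (b - c) s = A b s - A c s :=
      intervalIntegral.integral_sub (b.continuous.intervalIntegrable _ _)
        (c.continuous.intervalIntegrable _ _)
    by_cases hs : s ∈ Ioc 0 T <;> simp [F, hs, hAsub]
  have hΦ : ContractingWith (1 / 2) Φ := by
    refine ⟨by norm_num, LipschitzWith.of_dist_le_mul fun b c ↦ ?_⟩
    rw [BoundedContinuousFunction.dist_le (by positivity)]
    intro t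
    have : Φ c t - Φ b t = ∫ s in (0 : ℝ)..t, F (b - c) s := by
      simp only [← hFsub]
      rw [intervalIntegral.integral_sub (hFint b).intervalIntegrable (hFint c).intervalIntegrable]
      simp [Φ]
    rw [dist_comm, dist_eq_norm, this, dist_eq_norm]
    refine (hIle _ t).trans ?_
    push_cast
    gcongr
  let b := hΦ.fixedPoint Φ
  have hb : ∀ t, b t = η - ∫ s in (0 : ℝ)..t, F b s := fun t ↦
    (DFunLike.congr_fun hΦ.fixedPoint_isFixedPt t).symm
  refine ⟨A b, b, hAc b, b.continuous, by simp [A], by simp [hb 0], hA' b, fun t ht ↦ ?_⟩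
  have hnhds : Ioc 0 T ∈ 𝓝 t := Ioc_mem_nhds ht.1 ht.2
  have hcont : ContinuousAt (F b) t := ((hHA b).continuousAt hnhds).congr <| by
    filter_upwards [hnhds] with s hs
    exact (indicator_of_mem hs fun s ↦ H s (A b s)).symm
  have hd := (intervalIntegral.integral_hasDerivAt_right (a := 0) (hFint b).intervalIntegrable
    ((hFint b).aestronglyMeasurable.stronglyMeasurableAtFilter) hcont).const_sub η
  rw [show F b t = H t (A b t) from indicator_of_mem (Ioo_subset_Ioc_self ht) _] at hd
  exact hd.congr_of_eventuallyEq (.of_forall hb)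

end LinearSystem

section HessianBound

variable {E F G : Type*} [NormedAddCommGroup E] [NormedSpace ℝ E]
  [NormedAddCommGroup F] [InnerProductSpace ℝ F] [NormedAddCommGroup G] [NormedSpace ℝ G]

theorem norm_fderiv_fun_smul_le {c : E → ℝ} {f : E → G} {y : E} (hc : DifferentiableAt ℝ c y)
    (hf : DifferentiableAt ℝ f y) :
    ‖fderiv ℝ (fun z ↦ c z • f z) y‖ ≤ ‖c y‖ * ‖fderiv ℝ f y‖ + ‖fderiv ℝ c y‖ * ‖f y‖ := by
  rw [fderiv_fun_smul hc hf]
  refine (norm_add_le _ _).trans ?_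
  rw [norm_smul, ContinuousLinearMap.norm_smulRight_apply]

theorem fderiv_norm_comp {g : E → F} {y : E} (hg : DifferentiableAt ℝ g y) (h0 : g y ≠ 0) :
    fderiv ℝ (fun z ↦ ‖g z‖) y = ‖g y‖⁻¹ • (innerSL ℝ (g y)).comp (fderiv ℝ g y) := by
  have h := (hg.hasFDerivAt.norm_sq.sqrt (pow_ne_zero 2 (norm_ne_zero_iff.2 h0))).fderiv
  simp only [Real.sqrt_sq (norm_nonneg _)] at h
  rw [h, ← Nat.cast_smul_eq_nsmul ℝ, smul_smul]
  congr 1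
  field_simp
  norm_num

/-- The Hessian of `w |g| + V₀` blows up at most like `1 / |g|`, locally uniformly. -/
theorem exists_norm_fderiv_fderiv_mul_norm_le {w V₀ V : E → ℝ} {g : E → F}
    (hw : ContDiff ℝ 2 w) (hV₀ : ContDiff ℝ 2 V₀) (hg : ContDiff ℝ 2 g)
    (hV : ∀ y, V y = w y * ‖g y‖ + V₀ y) {S : Set E} (hS : IsCompact S) :
    ∃ M, ∀ y ∈ S, g y ≠ 0 → ‖fderiv ℝ (fderiv ℝ V) y‖ * ‖g y‖ ≤ M := by
  have hDw : ContDiff ℝ 1 (fderiv ℝ w) := hw.fderiv_right (by norm_num)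
  have hDg : ContDiff ℝ 1 (fderiv ℝ g) := hg.fderiv_right (by norm_num)
  have hDV₀ : ContDiff ℝ 1 (fderiv ℝ V₀) := hV₀.fderiv_right (by norm_num)
  let Q : E → E →L[ℝ] ℝ := fun y ↦ (innerSL ℝ (g y)).comp (fderiv ℝ g y)
  have hQ : ContDiff ℝ 1 Q :=
    ((innerSL ℝ).contDiff.comp (hg.of_le (by norm_num))).clm_comp hDg
  have hD2w := hDw.continuous_fderiv (by norm_num)
  have hD2V₀ := hDV₀.continuous_fderiv (by norm_num)
  have hD1Q := hQ.continuous_fderiv (by norm_num)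
  let Θ : E → ℝ := fun y ↦ ‖g y‖ ^ 2 * ‖fderiv ℝ (fderiv ℝ w) y‖
    + 2 * ‖g y‖ * ‖fderiv ℝ g y‖ * ‖fderiv ℝ w y‖
    + |w y| * (‖fderiv ℝ Q y‖ + ‖fderiv ℝ g y‖ ^ 2) + ‖g y‖ * ‖fderiv ℝ (fderiv ℝ V₀) y‖
  have hgn := hg.continuous.norm
  have hDgn := hDg.continuous.norm
  have hΘ : Continuous Θ :=
    ((((hgn.pow 2).mul hD2w.norm).add
      (((continuous_const.mul hgn).mul hDgn).mul hDw.continuous.norm)).add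
      (hw.continuous.abs.mul (hD1Q.norm.add (hDgn.pow 2)))).add (hgn.mul hD2V₀.norm)
  obtain ⟨M, hM⟩ := hS.bddAbove_image hΘ.continuousOn
  refine ⟨M, fun y hy h0 ↦ le_trans ?_ (hM (mem_image_of_mem Θ hy))⟩
  have hwd : Differentiable ℝ w := hw.differentiable (by norm_num)
  have hgd : Differentiable ℝ g := hg.differentiable (by norm_num)
  have hVd : Differentiable ℝ V₀ := hV₀.differentiable (by norm_num)
  have hDwd := hDw.differentiable (by norm_num)
  have hDVd := hDV₀.differentiable (by norm_num)
  have hQd := hQ.differentiable (by norm_num)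
  have hU : ∀ᶠ z in 𝓝 y, g z ≠ 0 := hg.continuous.continuousAt.eventually_ne h0
  have hr : ∀ z, g z ≠ 0 → DifferentiableAt ℝ (fun z ↦ ‖g z‖) z := fun z hz ↦ (hgd z).norm ℝ hz
  have hr' : ∀ z, g z ≠ 0 → fderiv ℝ (fun z ↦ ‖g z‖) z = ‖g z‖⁻¹ • Q z := fun z hz ↦
    fderiv_norm_comp (hgd z) hz
  have hrinv : DifferentiableAt ℝ (fun z ↦ ‖g z‖⁻¹) y := (hr y h0).fun_inv (norm_ne_zero_iff.2 h0)
  have hDV : fderiv ℝ V =ᶠ[𝓝 y] fun z ↦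
      ‖g z‖ • fderiv ℝ w z + w z • (‖g z‖⁻¹ • Q z) + fderiv ℝ V₀ z := by
    filter_upwards [hU] with z hz
    rw [funext hV, fderiv_fun_add ((hwd z).fun_mul (hr z hz)) (hVd z),
      fderiv_fun_mul (hwd z) (hr z hz), hr' z hz]
    congr 1
    exact add_comm _ _
  have hpos : 0 < ‖g y‖ := norm_pos_iff.2 h0
  have hQle : ‖Q y‖ ≤ ‖g y‖ * ‖fderiv ℝ g y‖ := by
    simpa using (innerSL ℝ (g y)).opNorm_comp_le (fderiv ℝ g y)
  have hNle : ‖‖g y‖⁻¹ • Q y‖ ≤ ‖fderiv ℝ g y‖ := by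
    rw [norm_smul, norm_inv, norm_norm, inv_mul_le_iff₀ hpos]
    exact hQle
  have hinv : ‖fderiv ℝ (fun z ↦ ‖g z‖⁻¹) y‖ ≤ (‖g y‖ ^ 2)⁻¹ * ‖fderiv ℝ g y‖ := by
    have h := ((hasDerivAt_inv hpos.ne').comp_hasFDerivAt y (hr y h0).hasFDerivAt).fderiv
    change fderiv ℝ (fun z ↦ ‖g z‖⁻¹) y = _ at h
    rw [h, norm_smul, hr' y h0, norm_neg, norm_inv, norm_pow, norm_norm]
    gcongr
  have h1 := norm_fderiv_fun_smul_le (hr y h0) (hDwd y)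
  have h2 := norm_fderiv_fun_smul_le (hwd y) (hrinv.fun_smul (hQd y))
  have h3 := norm_fderiv_fun_smul_le hrinv (hQd y)
  rw [hr' y h0, norm_norm] at h1
  rw [norm_inv, norm_norm] at h3
  have h3' : ‖fderiv ℝ (fun z ↦ ‖g z‖⁻¹ • Q z) y‖
      ≤ ‖g y‖⁻¹ * (‖fderiv ℝ Q y‖ + ‖fderiv ℝ g y‖ ^ 2) := by
    refine h3.trans ?_
    calc _ ≤ ‖g y‖⁻¹ * ‖fderiv ℝ Q y‖
          + (‖g y‖ ^ 2)⁻¹ * ‖fderiv ℝ g y‖ * (‖g y‖ * ‖fderiv ℝ g y‖) := by gcongr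
      _ = _ := by field_simp
  rw [hDV.fderiv_eq, fderiv_fun_add (((hr y h0).fun_smul (hDwd y)).fun_add
    ((hwd y).fun_smul (hrinv.fun_smul (hQd y)))) (hDVd y), fderiv_fun_add ((hr y h0).fun_smul (hDwd y))
    ((hwd y).fun_smul (hrinv.fun_smul (hQd y)))]
  calc _ ≤ ((‖g y‖ * ‖fderiv ℝ (fderiv ℝ w) y‖ + ‖fderiv ℝ g y‖ * ‖fderiv ℝ w y‖)
        + (|w y| * (‖g y‖⁻¹ * (‖fderiv ℝ Q y‖ + ‖fderiv ℝ g y‖ ^ 2))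
          + ‖fderiv ℝ w y‖ * ‖fderiv ℝ g y‖) + ‖fderiv ℝ (fderiv ℝ V₀) y‖) * ‖g y‖ := by
        gcongr
        refine norm_add₃_le.trans (add_le_add (add_le_add (h1.trans ?_) (h2.trans ?_)) le_rfl)
        · gcongr
        · rw [Real.norm_eq_abs]
          gcongr
    _ = Θ y := by
        simp only [Θ]
        field_simp
        ring

end HessianBound

open InnerProductSpace

section Gradient

variable {E : Type*} [NormedAddCommGroup E] [InnerProductSpace ℝ E] [CompleteSpace E]

/-- The inverse of the Riesz isomorphism of a real Hilbert space as a continuous linear map. -/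
noncomputable def rieszSymm (E : Type*) [NormedAddCommGroup E] [InnerProductSpace ℝ E]
    [CompleteSpace E] : (E →L[ℝ] ℝ) →L[ℝ] E :=
  LinearMap.mkContinuous
    { toFun := (toDual ℝ E).symm
      map_add' := map_add _
      map_smul' := fun c f ↦ by simp } 1 fun f ↦ by simp

theorem fderiv_gradient {V : E → ℝ} {y : E} (hV : ContDiffAt ℝ 2 V y) :
    fderiv ℝ (gradient V) y = (rieszSymm E).comp (fderiv ℝ (fderiv ℝ V) y) :=
  ((rieszSymm E).hasFDerivAt.comp y
    ((hV.fderiv_right (m := 1) (by norm_num)).differentiableAt (by norm_num)).hasFDerivAt).fderiv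

theorem continuousAt_fderiv_gradient {V : E → ℝ} {y : E} (hV : ContDiffAt ℝ 2 V y) :
    ContinuousAt (fderiv ℝ (gradient V)) y :=
  (((rieszSymm E).contDiff.contDiffAt.comp y (hV.fderiv_right (m := 1) (by norm_num))
    ).fderiv_right (m := 0) (by norm_num)).continuousAt

end Gradient

/-- A curve leaving a point with nonzero velocity moves away at least linearly. -/
theorem exists_mul_le_norm_sub_of_hasDerivWithinAt {F : Type*} [NormedAddCommGroup F]
    [NormedSpace ℝ F] {f : ℝ → F} {v : F} (hf : HasDerivWithinAt f v (Ici 0) 0) (hv : v ≠ 0) :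
    ∃ δ > 0, ∀ t ∈ Ioo 0 δ, ‖v‖ / 2 * t ≤ ‖f t - f 0‖ := by
  have h := (hasDerivWithinAt_iff_tendsto_slope.1 hf).norm
  rw [Ici_sdiff_left] at h
  have h2 := h.eventually (lt_mem_nhds (half_lt_self (norm_pos_iff.2 hv)))
  obtain ⟨δ, hδ, h3⟩ := (mem_nhdsGT_iff_exists_Ioo_subset).1 h2
  refine ⟨δ, hδ, fun t ht ↦ ?_⟩
  have h4 : ‖v‖ / 2 < ‖slope f 0 t‖ := h3 ht
  rw [slope_def_module, sub_zero, norm_smul, norm_inv, Real.norm_of_nonneg ht.1.le,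
    lt_inv_mul_iff₀ ht.1] at h4
  linarith

/-- Along an outgoing broken trajectory through (x₀,ξ₀) ∈ S*, the linearized (variational)
system J'(t) = M(t) J(t), M(t) = [[0, Id],[−d²V(x_t), 0]], with initial data J(0) = (0,η),
has a unique continuous solution on some interval [0,τ'], despite the 1/t blow-up of the
Hessian d²V(x_t) as t → 0⁺. -/
theorem stmt18 (d p : ℕ) (hd : 1 ≤ d) (hp : 1 ≤ p) (hpd : p ≤ d)
    (w V₀ : EuclideanSpace ℝ (Fin d) → ℝ)
    (g : EuclideanSpace ℝ (Fin d) → EuclideanSpace ℝ (Fin p))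
    (hw : ContDiff ℝ (⊤ : ℕ∞) w) (hV₀ : ContDiff ℝ (⊤ : ℕ∞) V₀) (hg : ContDiff ℝ (⊤ : ℕ∞) g)
    (V : EuclideanSpace ℝ (Fin d) → ℝ) (hV : ∀ y, V y = w y * ‖g y‖ + V₀ y)
    (x₀ ξ₀ : EuclideanSpace ℝ (Fin d)) (hgx₀ : g x₀ = 0) (hdg : fderiv ℝ g x₀ ξ₀ ≠ 0)
    (τ : ℝ) (hτ : 0 < τ)
    (x ξ : ℝ → EuclideanSpace ℝ (Fin d))
    (K : NNReal)
    (hLip : LipschitzOnWith K (fun t => (x t, ξ t)) (Set.Icc 0 τ))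
    (hx0 : x 0 = x₀) (hξ0 : ξ 0 = ξ₀)
    (hne : ∀ t ∈ Set.Ioc 0 τ, g (x t) ≠ 0)
    (hode : ∀ t ∈ Set.Ioc 0 τ,
      HasDerivAt x (ξ t) t ∧ HasDerivAt ξ (-gradient V (x t)) t) :
    ∀ η : EuclideanSpace ℝ (Fin d),
      ∃ τ' : ℝ, 0 < τ' ∧ τ' ≤ τ ∧
        ∃ J : ℝ → EuclideanSpace ℝ (Fin d) × EuclideanSpace ℝ (Fin d),
          (ContinuousOn J (Set.Icc 0 τ') ∧ J 0 = (0, η) ∧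
            ∀ t ∈ Set.Ioc 0 τ',
              HasDerivAt J ((J t).2, -(fderiv ℝ (fun y => gradient V y) (x t) (J t).1)) t) ∧
          ∀ J₂ : ℝ → EuclideanSpace ℝ (Fin d) × EuclideanSpace ℝ (Fin d),
            (ContinuousOn J₂ (Set.Icc 0 τ') ∧ J₂ 0 = (0, η) ∧
              ∀ t ∈ Set.Ioc 0 τ',
                HasDerivAt J₂ ((J₂ t).2, -(fderiv ℝ (fun y => gradient V y) (x t) (J₂ t).1)) t) →
            ∀ t ∈ Set.Icc 0 τ', J₂ t = J t := by
  intro η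
  have h2le : (2 : WithTop ℕ∞) ≤ ((⊤ : ℕ∞) : WithTop ℕ∞) :=
    WithTop.coe_le_coe.2 le_top
  have hw2 := hw.of_le h2le
  have hV2 := hV₀.of_le h2le
  have hg2 := hg.of_le h2le
  have hVcd : ∀ y, g y ≠ 0 → ContDiffAt ℝ 2 V y := fun y hy ↦ by
    rw [funext hV]
    exact (hw2.contDiffAt.mul (hg2.contDiffAt.norm ℝ hy)).add hV2.contDiffAt
  have hxc : ContinuousOn x (Icc 0 τ) := hLip.continuousOn.fst
  have hξc : ContinuousOn ξ (Icc 0 τ) := hLip.continuousOn.snd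
  let H : ℝ → EuclideanSpace ℝ (Fin d) →L[ℝ] EuclideanSpace ℝ (Fin d) :=
    fun t ↦ fderiv ℝ (gradient V) (x t)
  have hHc : ContinuousOn H (Ioc 0 τ) := fun t ht ↦
    (ContinuousAt.comp (continuousAt_fderiv_gradient (hVcd _ (hne t ht)))
      (hode t ht).1.continuousAt).continuousWithinAt
  obtain ⟨M, hM⟩ := exists_norm_fderiv_fderiv_mul_norm_le hw2 hV2 hg2 hV
    (isCompact_Icc.image_of_continuousOn hxc)
  have hx' : HasDerivWithinAt x ξ₀ (Ici 0) 0 := by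
    refine hasDerivWithinAt_Ici_of_tendsto_deriv (s := Ioc 0 τ)
      (fun t ht ↦ (hode t ht).1.differentiableAt.differentiableWithinAt)
      ((hxc 0 ⟨le_rfl, hτ.le⟩).mono Ioc_subset_Icc_self) (Ioc_mem_nhdsGT hτ) ?_
    rw [← hξ0]
    refine ((hξc 0 ⟨le_rfl, hτ.le⟩).mono_of_mem_nhdsWithin (Icc_mem_nhdsGT hτ)).congr' ?_
    filter_upwards [Ioc_mem_nhdsGT hτ] with t ht using (hode t ht).1.deriv.symm
  have hgx' : HasDerivWithinAt (g ∘ x) (fderiv ℝ g x₀ ξ₀) (Ici 0) 0 := by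
    refine HasFDerivAt.comp_hasDerivWithinAt (0 : ℝ) ?_ hx'
    rw [hx0]
    exact (hg2.differentiable (by norm_num) x₀).hasFDerivAt
  obtain ⟨δ, hδ, hδg⟩ := exists_mul_le_norm_sub_of_hasDerivWithinAt hgx' hdg
  set c := ‖fderiv ℝ g x₀ ξ₀‖ / 2
  have hcpos : 0 < c := half_pos (norm_pos_iff.2 hdg)
  let C := ‖rieszSymm (EuclideanSpace ℝ (Fin d))‖ * |M| / c
  have hC : 0 ≤ C := by positivity
  have hHle : ∀ t ∈ Ioc 0 τ, t < δ → ‖H t‖ * t ≤ C := fun t ht htδ ↦ by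
    have h1 : c * t ≤ ‖g (x t)‖ := by simpa [hx0, hgx₀] using hδg t ⟨ht.1, htδ⟩
    have h2 := hM (x t) (mem_image_of_mem x (Ioc_subset_Icc_self ht)) (hne t ht)
    have h3 : ‖H t‖ ≤ ‖rieszSymm (EuclideanSpace ℝ (Fin d))‖ * ‖fderiv ℝ (fderiv ℝ V) (x t)‖ := by
      simp only [H, fderiv_gradient (hVcd _ (hne t ht))]
      exact ContinuousLinearMap.opNorm_comp_le _ _
    rw [le_div_iff₀ hcpos]
    calc ‖H t‖ * t * c = ‖H t‖ * (c * t) := by ring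
      _ ≤ ‖rieszSymm (EuclideanSpace ℝ (Fin d))‖ * ‖fderiv ℝ (fderiv ℝ V) (x t)‖
          * ‖g (x t)‖ := by have := ht.1; gcongr
      _ = ‖rieszSymm (EuclideanSpace ℝ (Fin d))‖ * (‖fderiv ℝ (fderiv ℝ V) (x t)‖
          * ‖g (x t)‖) := by ring
      _ ≤ ‖rieszSymm (EuclideanSpace ℝ (Fin d))‖ * |M| := by
          gcongr
          exact h2.trans (le_abs_self M)
  obtain ⟨T, hT, hTlt⟩ : ∃ T > 0, T < min (min τ δ) (1 / (2 * (C + 1))) :=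
    exists_between (by positivity)
  simp only [lt_min_iff] at hTlt
  obtain ⟨⟨hTτ, hTδ⟩, hTC⟩ := hTlt
  have hCT : C * T ≤ 1 / 2 := by
    rw [lt_div_iff₀ (by positivity)] at hTC
    nlinarith
  have hbd : ∀ t ∈ Ioc 0 T, ‖H t‖ * t ≤ C := fun t ht ↦
    hHle t ⟨ht.1, ht.2.trans hTτ.le⟩ (ht.2.trans_lt hTδ)
  obtain ⟨a, b, ha, hb, ha0, hb0, ha', hb'⟩ := exists_hasDerivAt_of_singular hT hCT
    (hHc.mono (Ioc_subset_Ioc_right hTτ.le)) hbd η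
  have hT2 : T / 2 < T := half_lt_self hT
  refine ⟨T / 2, half_pos hT, by linarith, fun t ↦ (a t, b t),
    ⟨(ha.prodMk hb).continuousOn, by simp [ha0, hb0], fun t ht ↦
      (ha' t).prodMk (hb' t ⟨ht.1, ht.2.trans_lt hT2⟩)⟩, ?_⟩
  rintro J ⟨hJc, hJ0, hJ'⟩ t ht
  have hJ1 : ∀ s ∈ Ioo 0 (T / 2), HasDerivAt (fun s ↦ (J s).1) (J s).2 s := fun s hs ↦
    (hJ' s (Ioo_subset_Ioc_self hs)).fst
  have hJ2 : ∀ s ∈ Ioo 0 (T / 2), HasDerivAt (fun s ↦ (J s).2) (-(H s (J s).1)) s := fun s hs ↦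
    (hJ' s (Ioo_subset_Ioc_self hs)).snd
  obtain ⟨h1, h2⟩ := eq_zero_of_hasDerivAt_of_singular (H := H) (T := T / 2) hC
    (a := fun s ↦ (J s).1 - a s) (b := fun s ↦ (J s).2 - b s) (by nlinarith)
    (fun s hs ↦ hbd s ⟨hs.1, hs.2.trans hT2.le⟩)
    (hJc.fst.sub ha.continuousOn) (hJc.snd.sub hb.continuousOn) (by simp [hJ0, ha0])
    (by simp [hJ0, hb0]) (fun s hs ↦ (hJ1 s hs).sub (ha' s))
    (fun s hs ↦ by
      refine ((hJ2 s hs).fun_sub (hb' s ⟨hs.1, hs.2.trans hT2⟩)).congr_deriv ?_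
      rw [map_sub]
      abel) ht
  exact Prod.ext (sub_eq_zero.1 h1) (sub_eq_zero.1 h2)
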